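/- arXiv:1407.2529 — 3 statements merged into one kernel-verified Lean document; each statement's English description precedes it below -/
import Mathlib

section
/- Let k be a perfect field and let f : X → S be a morphism of smooth varieties over k (i.e., X and S are integral, separated schemes of finite type over k that are smooth over k). Let ξ be the generic point of S, κ := κ(ξ) its residue field (the function field of S), and κ̄ an algebraic closure of κ. Then the generic fiber X_ξ := X ×_S Spec κ is a regular scheme, and for every point x̄ of the geometric generic fiber X̄_ξ := X_ξ ×_{Spec κ} Spec κ̄, the local ring O := O_{X̄_ξ, x̄} satisfies edim(O) ≤ dim(O) + dim(S); equivalently, the embedding codimension ecodim(x̄) := edim(O) − dim(O) is at most dim(S). -/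
open AlgebraicGeometry CategoryTheory Limits IsLocalRing

/-- The embedding dimension of a local ring: the dimension of the Zariski cotangent space
`m/m²` over the residue field. -/
noncomputable def edim (R : Type*) [CommRing R] [IsLocalRing R] : ℕ :=
  Module.finrank (ResidueField R) (CotangentSpace R)

/-- A scheme is regular if it is locally Noetherian and all of its stalks are regular local
rings (i.e. the Krull dimension of each stalk equals its embedding dimension). -/
def SchemeRegular (X : Scheme) : Prop :=
  IsLocallyNoetherian X ∧
    ∀ x : X, ringKrullDim (X.presheaf.stalk x) = (edim (X.presheaf.stalk x) : WithBot ℕ∞)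

/-- A scheme over a field `k` is smooth over `k` if it is locally of finite type over `k` and
its base change to an algebraic closure of `k` is regular. -/
def SmoothOverField (k : Type) [Field k] (X : Scheme)
    (f : X ⟶ Spec (CommRingCat.of k)) : Prop :=
  LocallyOfFiniteType f ∧
    SchemeRegular (pullback f
      (Spec.map (CommRingCat.ofHom (algebraMap k (AlgebraicClosure k)))))


namespace GGF
open TensorProduct KaehlerDifferential

lemma exists_conormal (k A : Type) [Field k] [CommRing A] [IsLocalRing A] [Algebra k A]
    [Algebra.FormallySmooth k (ResidueField A)] (I : Ideal A)
    (hI : I = RingHom.ker (algebraMap A (ResidueField A))) :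
    ∃ f : I.Cotangent →ₗ[A] (ResidueField A) ⊗[A] Ω[A⁄k], Function.Injective f ∧
      Function.Exact f (KaehlerDifferential.mapBaseChange k A (ResidueField A)) := by
  subst hI
  have hs : Function.Surjective (algebraMap A (ResidueField A)) := residue_surjective
  refine ⟨kerCotangentToTensor k A (ResidueField A), ?_,
    exact_kerCotangentToTensor_mapBaseChange k A _ hs⟩
  let φ : A →ₐ[k] ResidueField A := IsScalarTower.toAlgHom k A (ResidueField A)
  have hφ : Function.Surjective φ.kerSquareLift := by
    intro x
    obtain ⟨a, rfl⟩ := hs x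
    exact ⟨Ideal.Quotient.mk _ a, rfl⟩
  have hnil : IsNilpotent (RingHom.ker φ.kerSquareLift.toRingHom) := by
    refine ⟨2, ?_⟩
    have := φ.ker_kerSquareLift
    rw [this]
    exact Ideal.cotangentIdeal_square _
  let g := Algebra.FormallySmooth.liftOfSurjective (AlgHom.id k (ResidueField A))
    φ.kerSquareLift hφ hnil
  have hg : φ.kerSquareLift.comp g = AlgHom.id k _ :=
    Algebra.FormallySmooth.comp_liftOfSurjective _ _ hφ hnil
  obtain ⟨l, hl⟩ := (retractionKerCotangentToTensorEquivSection (R := k) hs).symm ⟨g, hg⟩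
  exact Function.LeftInverse.injective (g := l) (fun x => LinearMap.congr_fun hl x)

lemma finrank_conormal (k A : Type) [Field k] [CommRing A] [IsLocalRing A] [Algebra k A]
    [IsNoetherianRing A] [Algebra.EssFiniteType k A]
    [Algebra.FormallySmooth k (ResidueField A)] :
    Module.finrank (ResidueField A) ((ResidueField A) ⊗[A] Ω[A⁄k]) =
      edim A + Module.finrank (ResidueField A) Ω[ResidueField A⁄k] := by
  have hs : Function.Surjective (algebraMap A (ResidueField A)) := residue_surjective
  obtain ⟨f, hf, hex⟩ := exists_conormal k A (maximalIdeal A) IsLocalRing.ker_residue.symm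
  let f' : CotangentSpace A →ₗ[ResidueField A] (ResidueField A) ⊗[A] Ω[A⁄k] :=
    LinearMap.extendScalarsOfSurjective hs f
  let g := KaehlerDifferential.mapBaseChange k A (ResidueField A)
  have hg : Function.Surjective g := KaehlerDifferential.mapBaseChange_surjective k A _ hs
  have h1 := LinearMap.finrank_range_add_finrank_ker g
  have h2 : LinearMap.ker g = LinearMap.range f' := by
    ext x; exact hex x
  rw [h2, LinearMap.finrank_range_of_inj (f := f') hf, LinearMap.range_eq_top.mpr hg,
    finrank_top] at h1
  rw [← h1, edim, add_comm]

open scoped IntermediateField.algebraAdjoinAdjoin in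
lemma finrank_kaehler_field (k L : Type) [Field k] [Field L] [Algebra k L] [PerfectField k]
    [Algebra.EssFiniteType k L] :
    (Module.finrank L Ω[L⁄k] : Cardinal) = Algebra.trdeg k L := by
  obtain ⟨s, hs, H⟩ := exists_isTranscendenceBasis_and_isSeparable_of_perfectField k L
  have : Algebra.IsSeparable (IntermediateField.adjoin k (Set.range ((↑) : s → L))) L := by
    convert! H <;> simp
  have h0 : Algebra.FormallyEtale (IntermediateField.adjoin k (Set.range ((↑) : s → L))) L :=
    Algebra.FormallyEtale.of_isSeparable _ L
  have h2 : Algebra.FormallyEtale (Algebra.adjoin k (Set.range ((↑) : s → L)))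
      (IntermediateField.adjoin k (Set.range ((↑) : s → L))) :=
    .of_isLocalization (nonZeroDivisors _)
  have h1 : Algebra.FormallyEtale (Algebra.adjoin k (Set.range ((↑) : s → L))) L :=
    .comp _ (IntermediateField.adjoin k (Set.range ((↑) : s → L))) _
  let e := hs.1.aevalEquiv
  let : Algebra (MvPolynomial s k) (Algebra.adjoin k (Set.range ((↑) : s → L))) :=
    e.toRingEquiv.toRingHom.toAlgebra
  let : Algebra (MvPolynomial s k) L :=
    ((algebraMap (Algebra.adjoin k (Set.range ((↑) : s → L))) L).comp
      e.toRingEquiv.toRingHom).toAlgebra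
  have : IsScalarTower (MvPolynomial s k) (Algebra.adjoin k (Set.range ((↑) : s → L))) L :=
    .of_algebraMap_eq' rfl
  have h3 : Algebra.FormallyEtale (MvPolynomial s k)
      (Algebra.adjoin k (Set.range ((↑) : s → L))) :=
    .of_equiv (A := MvPolynomial s k)
      { e.toRingEquiv with commutes' := fun r => rfl }
  have h4 : Algebra.FormallyEtale (MvPolynomial s k) L :=
    .comp _ (Algebra.adjoin k (Set.range ((↑) : s → L))) _
  have : IsScalarTower k (MvPolynomial s k) L := .of_algebraMap_eq (fun r => by
    change _ = ((e (algebraMap k _ r) : Algebra.adjoin k (Set.range ((↑) : s → L))) : L)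
    rw [e.commutes]; rfl)
  let E := tensorKaehlerEquivOfFormallyEtale k (MvPolynomial s k) L
  let b := (KaehlerDifferential.mvPolynomialBasis k s).baseChange L
  rw [← E.finrank_eq, Module.finrank_eq_card_basis b, ← hs.cardinalMk_eq_trdeg]
  simp


lemma trdeg_le_ringKrullDim (k R K : Type) [Field k] [CommRing R] [IsDomain R] [Algebra k R]
    [Algebra.FiniteType k R] [Field K] [Algebra R K] [IsFractionRing R K] [Algebra k K]
    [IsScalarTower k R K] :
    ∃ t : ℕ, Algebra.trdeg k K = t ∧ (t : WithBot ℕ∞) ≤ ringKrullDim R := by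
  obtain ⟨s, g, hg, hfin⟩ := exists_integral_inj_algHom_of_fg k R
  let := g.toRingHom.toAlgebra
  have : IsScalarTower k (MvPolynomial (Fin s) k) R := .of_algebraMap_eq (fun r => (g.commutes r).symm)
  have hint : Algebra.IsIntegral (MvPolynomial (Fin s) k) R := ⟨hfin⟩
  refine ⟨s, ?_, ?_⟩
  · have h1 : Algebra.trdeg k (MvPolynomial (Fin s) k) = s := by
      simp [MvPolynomial.trdeg_of_isDomain]
    have : FaithfulSMul (MvPolynomial (Fin s) k) R := (faithfulSMul_iff_algebraMap_injective _ _).mpr hg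
    have h2 := _root_.trdeg_add_eq k (MvPolynomial (Fin s) k) (A := R)
    have h3 := _root_.trdeg_add_eq k R (A := K)
    have : Algebra.IsAlgebraic R K := IsLocalization.isAlgebraic _ (nonZeroDivisors R)
    rw [trdeg_eq_zero (R := MvPolynomial (Fin s) k), add_zero] at h2
    rw [trdeg_eq_zero (R := R), add_zero] at h3
    rw [← h3, ← h2, h1]
  · have h1 : ringKrullDim (MvPolynomial (Fin s) k) = s := by
      rw [MvPolynomial.ringKrullDim_of_isNoetherianRing]; simp
    rw [← h1]
    refine iSup_le fun l => ?_
    obtain ⟨Q, -, hQ, hQ'⟩ := Ideal.exists_ideal_over_prime_of_isIntegral (S := R) l.head.asIdeal ⊥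
      (by rw [← RingHom.ker_eq_comap_bot, (RingHom.injective_iff_ker_eq_bot (algebraMap (MvPolynomial (Fin s) k) R)).mp hg]; exact bot_le)
    have : Q.LiesOver l.head.asIdeal := ⟨hQ'.symm⟩
    obtain ⟨L, hL, -⟩ := Ideal.exists_ltSeries_of_hasGoingUp l Q
    rw [← hL]
    exact le_iSup (fun p : LTSeries (PrimeSpectrum R) => (p.length : WithBot ℕ∞)) L



section base
attribute [local instance] Algebra.TensorProduct.rightAlgebra

noncomputable def commEquiv (K L B : Type) [Field K] [Field L] [Algebra K L]
    [CommRing B] [Algebra K B] : B ⊗[K] L ≃ₐ[B] L ⊗[K] B :=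
  AlgEquiv.ofRingEquiv (f := (Algebra.TensorProduct.comm K B L).toRingEquiv) (fun r => by
    simp [Algebra.TensorProduct.algebraMap_apply]
    rfl)

lemma isIntegral_tensor (K L B : Type) [Field K] [Field L] [Algebra K L] [Algebra.IsAlgebraic K L]
    [CommRing B] [Algebra K B] : Algebra.IsIntegral B (L ⊗[K] B) := by
  have : Algebra.IsIntegral K L := inferInstance
  have h : Algebra.IsIntegral B (B ⊗[K] L) := inferInstance
  exact Algebra.IsIntegral.of_surjective (commEquiv K L B).toAlgHom (commEquiv K L B).surjective

lemma flat_tensor (K L B : Type) [Field K] [Field L] [Algebra K L]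
    [CommRing B] [Algebra K B] : Module.Flat B (L ⊗[K] B) :=
  Module.Flat.of_linearEquiv (commEquiv K L B).symm.toLinearEquiv

lemma height_eq (K L B : Type) [Field K] [Field L] [Algebra K L] [Algebra.IsAlgebraic K L]
    [CommRing B] [Algebra K B] [Algebra.FiniteType K B]
    (q : Ideal (L ⊗[K] B)) [q.IsPrime] (p : Ideal B) [p.IsPrime] [q.LiesOver p] : q.height = p.height := by
  have := isIntegral_tensor K L B
  have := flat_tensor K L B
  have : IsNoetherianRing B := Algebra.FiniteType.isNoetherianRing K B
  have : IsNoetherianRing (L ⊗[K] B) := Algebra.FiniteType.isNoetherianRing L _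
  apply le_antisymm
  · have hm : StrictMono (PrimeSpectrum.comap (algebraMap B (L ⊗[K] B))) := by
      intro I J hIJ
      exact Ideal.IsIntegral.comap_lt_comap (R := B) (I := I.asIdeal) (J := J.asIdeal) hIJ
    have := Order.height_le_height_apply_of_strictMono _ hm ⟨q, inferInstance⟩
    have e : PrimeSpectrum.comap (algebraMap B (L ⊗[K] B)) ⟨q, inferInstance⟩ = ⟨p, inferInstance⟩ := by
      ext1; exact (q.over_def p).symm
    rw [e] at this
    rwa [← PrimeSpectrum.height_eq_orderHeight, ← PrimeSpectrum.height_eq_orderHeight] at this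
  · rw [Ideal.height_eq_height_add_of_liesOver_of_hasGoingDown p q]
    exact le_self_add

lemma trdeg_eq (K L B : Type) [Field K] [Field L] [Algebra K L] [Algebra.IsAlgebraic K L]
    [CommRing B] [Algebra K B] [Algebra.FiniteType K B]
    (q : Ideal (L ⊗[K] B)) [q.IsPrime] (p : Ideal B) [p.IsPrime] [q.LiesOver p] :
    Algebra.trdeg L q.ResidueField = Algebra.trdeg K p.ResidueField := by
  have := isIntegral_tensor K L B
  let := Localization.AtPrime.algebraOfLiesOver p q
  have : IsScalarTower K p.ResidueField q.ResidueField := by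
    refine .of_algebraMap_eq (fun r => ?_)
    rw [IsScalarTower.algebraMap_apply K B p.ResidueField, ← IsScalarTower.algebraMap_apply B p.ResidueField q.ResidueField,
      IsScalarTower.algebraMap_apply K B q.ResidueField]
  have h1 := _root_.trdeg_add_eq K L (A := q.ResidueField)
  have h2 := _root_.trdeg_add_eq K p.ResidueField (A := q.ResidueField)
  rw [trdeg_eq_zero (R := K), zero_add] at h1
  rw [trdeg_eq_zero (R := p.ResidueField), add_zero] at h2
  rw [h1, h2]

lemma finrank_loc (K B : Type) [Field K]
    [CommRing B] [Algebra K B] (p : Ideal B) [p.IsPrime] :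
    Module.finrank p.ResidueField
      (p.ResidueField ⊗[Localization.AtPrime p] Ω[Localization.AtPrime p⁄K]) =
    Module.finrank p.ResidueField (p.ResidueField ⊗[B] Ω[B⁄K]) := by
  have : Algebra.FormallyEtale B (Localization.AtPrime p) := .of_isLocalization p.primeCompl
  let E := tensorKaehlerEquivOfFormallyEtale K B (Localization.AtPrime p)
  let E2 := AlgebraTensorModule.cancelBaseChange B (Localization.AtPrime p) p.ResidueField p.ResidueField Ω[B⁄K]
  rw [← E2.finrank_eq]
  exact (LinearEquiv.finrank_eq (E.baseChange (Localization.AtPrime p) p.ResidueField _ _)).symm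

lemma finrank_eq (K L B : Type) [Field K] [Field L] [Algebra K L]
    [CommRing B] [Algebra K B]
    (q : Ideal (L ⊗[K] B)) [q.IsPrime] (p : Ideal B) [p.IsPrime] [q.LiesOver p] :
    Module.finrank q.ResidueField
      (q.ResidueField ⊗[Localization.AtPrime q] Ω[Localization.AtPrime q⁄L]) =
    Module.finrank p.ResidueField
      (p.ResidueField ⊗[Localization.AtPrime p] Ω[Localization.AtPrime p⁄K]) := by
  let := Localization.AtPrime.algebraOfLiesOver p q
  rw [finrank_loc, finrank_loc]
  let E := tensorKaehlerEquiv K L B (L ⊗[K] B)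
  let E1 := E.baseChange (L ⊗[K] B) q.ResidueField _ _
  let E2 := AlgebraTensorModule.cancelBaseChange B (L ⊗[K] B) q.ResidueField q.ResidueField Ω[B⁄K]
  let E3 := AlgebraTensorModule.cancelBaseChange B p.ResidueField q.ResidueField q.ResidueField Ω[B⁄K]
  rw [← E1.finrank_eq, E2.finrank_eq, ← E3.finrank_eq, Module.finrank_baseChange]
end base


lemma exists_trdeg (K B : Type) [Field K] [CommRing B] [Algebra K B] [Algebra.FiniteType K B]
    (p : Ideal B) [p.IsPrime] : ∃ t : ℕ, Algebra.trdeg K p.ResidueField = t := by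
  obtain ⟨t, ht, -⟩ := trdeg_le_ringKrullDim K (B ⧸ p) p.ResidueField
  exact ⟨t, ht⟩

lemma perfect_main (k A : Type) [Field k] [PerfectField k] [CommRing A] [IsLocalRing A]
    [Algebra k A] [IsNoetherianRing A] [Algebra.EssFiniteType k A] (t : ℕ)
    (ht : Algebra.trdeg k (ResidueField A) = t) :
    edim A + t = Module.finrank (ResidueField A) ((ResidueField A) ⊗[A] Ω[A⁄k]) := by
  have : Algebra.EssFiniteType A (ResidueField A) := inferInstance
  have : Algebra.EssFiniteType k (ResidueField A) := .comp k A _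
  rw [finrank_conormal]
  congr 1
  rw [← finrank_kaehler_field k (ResidueField A)] at ht
  exact_mod_cast ht.symm

section base
attribute [local instance] Algebra.TensorProduct.rightAlgebra

lemma base_main (K L B : Type) [Field K] [Field L] [Algebra K L] [Algebra.IsAlgebraic K L]
    [PerfectField L] [CommRing B] [Algebra K B] [Algebra.FiniteType K B]
    (q : Ideal (L ⊗[K] B)) [q.IsPrime] (p : Ideal B) [p.IsPrime] [q.LiesOver p] (t : ℕ)
    (ht : Algebra.trdeg K p.ResidueField = t) :
    ringKrullDim (Localization.AtPrime q) = ringKrullDim (Localization.AtPrime p) ∧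
    edim (Localization.AtPrime q) + t = Module.finrank p.ResidueField
      (p.ResidueField ⊗[Localization.AtPrime p] Ω[Localization.AtPrime p⁄K]) := by
  have : IsNoetherianRing (L ⊗[K] B) := Algebra.FiniteType.isNoetherianRing L _
  have : IsNoetherianRing (Localization.AtPrime q) :=
    IsLocalization.isNoetherianRing q.primeCompl _ inferInstance
  have : Algebra.EssFiniteType L (Localization.AtPrime q) := .comp L (L ⊗[K] B) _
  constructor
  · rw [IsLocalization.AtPrime.ringKrullDim_eq_height q,
      IsLocalization.AtPrime.ringKrullDim_eq_height p, height_eq K L B q p]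
  · rw [← finrank_eq K L B q p]
    apply perfect_main
    rw [← ht]
    exact trdeg_eq K L B q p

lemma regular_descend (k L B : Type) [Field k] [PerfectField k] [Field L] [Algebra k L]
    [Algebra.IsAlgebraic k L] [PerfectField L] [CommRing B] [Algebra k B] [Algebra.FiniteType k B]
    (h : ∀ (q : Ideal (L ⊗[k] B)) [q.IsPrime],
      ringKrullDim (Localization.AtPrime q) = (edim (Localization.AtPrime q) : WithBot ℕ∞))
    (p : Ideal B) [p.IsPrime] :
    ringKrullDim (Localization.AtPrime p) = (edim (Localization.AtPrime p) : WithBot ℕ∞) := by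
  have := isIntegral_tensor k L B
  have : IsNoetherianRing B := Algebra.FiniteType.isNoetherianRing k _
  have : IsNoetherianRing (Localization.AtPrime p) :=
    IsLocalization.isNoetherianRing p.primeCompl _ inferInstance
  have : Algebra.EssFiniteType k (Localization.AtPrime p) := .comp k B _
  obtain ⟨q, -, hq, hq'⟩ := Ideal.exists_ideal_over_prime_of_isIntegral (S := L ⊗[k] B) p ⊥ (by
    rw [← RingHom.ker_eq_comap_bot, (RingHom.injective_iff_ker_eq_bot _).mp]
    · exact bot_le
    · exact Algebra.TensorProduct.includeRight_injective (algebraMap k L).injective)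
  have : q.LiesOver p := ⟨hq'.symm⟩
  obtain ⟨t, ht⟩ := exists_trdeg k B p
  obtain ⟨h1, h2⟩ := base_main k L B q p t ht
  rw [← h1, h q]
  have h3 := perfect_main k (Localization.AtPrime p) t ht
  congr 1
  have : edim (Localization.AtPrime q) + t = edim (Localization.AtPrime p) + t := h2.trans h3.symm
  omega

lemma edim_le_main (k K L C : Type) [Field k] [PerfectField k] [Field K] [Algebra k K] [Field L]
    [Algebra K L] [Algebra.IsAlgebraic K L] [PerfectField L] [CommRing C] [Algebra K C]
    [Algebra.FiniteType K C] [Algebra k C] [IsScalarTower k K C] [Algebra.EssFiniteType k K]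
    (s : ℕ) (hs : Algebra.trdeg k K = s)
    (h : ∀ (p : Ideal C) [p.IsPrime],
      ringKrullDim (Localization.AtPrime p) = (edim (Localization.AtPrime p) : WithBot ℕ∞))
    (q : Ideal (L ⊗[K] C)) [q.IsPrime] :
    (edim (Localization.AtPrime q) : WithBot ℕ∞) ≤
      ringKrullDim (Localization.AtPrime q) + (s : WithBot ℕ∞) := by
  let p := q.under C
  have : p.IsPrime := inferInstanceAs (Ideal.comap _ _).IsPrime
  have : q.LiesOver p := ⟨rfl⟩
  have : IsNoetherianRing C := Algebra.FiniteType.isNoetherianRing K _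
  have : IsNoetherianRing (Localization.AtPrime p) :=
    IsLocalization.isNoetherianRing p.primeCompl _ inferInstance
  have : Algebra.EssFiniteType k C := .comp k K C
  have : Algebra.EssFiniteType k (Localization.AtPrime p) := .comp k C _
  obtain ⟨t, ht⟩ := exists_trdeg K C p
  obtain ⟨h1, h2⟩ := base_main K L C q p t ht
  have : IsScalarTower k K (Localization.AtPrime p) := .of_algebraMap_eq (fun r => by
    rw [IsScalarTower.algebraMap_apply k C, IsScalarTower.algebraMap_apply k K C,
      ← IsScalarTower.algebraMap_apply K C])
  have : IsScalarTower k K p.ResidueField := .of_algebraMap_eq (fun r => by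
    rw [IsScalarTower.algebraMap_apply k C, IsScalarTower.algebraMap_apply k K C,
      ← IsScalarTower.algebraMap_apply K C])
  have ht2 : Algebra.trdeg k p.ResidueField = (s + t : ℕ) := by
    rw [← _root_.trdeg_add_eq k K (A := p.ResidueField), hs, ht, Nat.cast_add]
  have h3 := perfect_main k (Localization.AtPrime p) (s + t) ht2
  let φ : Ω[Localization.AtPrime p⁄k] →ₗ[Localization.AtPrime p] Ω[Localization.AtPrime p⁄K] :=
    KaehlerDifferential.map k K (Localization.AtPrime p) (Localization.AtPrime p)
  have hφ : Function.Surjective φ :=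
    KaehlerDifferential.map_surjective_of_surjective _ _ _ _ Function.surjective_id
  have h4 : Module.finrank p.ResidueField
      (p.ResidueField ⊗[Localization.AtPrime p] Ω[Localization.AtPrime p⁄K]) ≤
      Module.finrank p.ResidueField
      (p.ResidueField ⊗[Localization.AtPrime p] Ω[Localization.AtPrime p⁄k]) :=
    LinearMap.finrank_le_finrank_of_surjective (f := φ.baseChange p.ResidueField)
      (LinearMap.lTensor_surjective _ hφ)
  have h5 : edim (Localization.AtPrime q) ≤ edim (Localization.AtPrime p) + s := by
    have : edim (Localization.AtPrime q) + t ≤ edim (Localization.AtPrime p) + (s + t) :=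
      h2.le.trans (h4.trans h3.ge)
    omega
  rw [h1, h p]
  exact_mod_cast h5
end base


lemma edim_eq_of_ringEquiv {A A' : Type} [CommRing A] [CommRing A'] [IsLocalRing A]
    [IsLocalRing A'] [IsNoetherianRing A] (e : A ≃+* A') : edim A = edim A' := by
  have : IsNoetherianRing A' := isNoetherianRing_of_ringEquiv A e
  unfold edim
  rw [← IsLocalRing.spanFinrank_maximalIdeal_eq_finrank_cotangentSpace,
    ← IsLocalRing.spanFinrank_maximalIdeal_eq_finrank_cotangentSpace,
    ← map_ringEquiv_maximalIdeal e, Ideal.spanFinrank_map_eq_of_ringEquiv]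

lemma generic_loc (R K B : Type) [CommRing R] [IsDomain R] [Field K] [Algebra R K]
    [IsFractionRing R K] [CommRing B] [Algebra R B] [IsNoetherianRing B]
    (h : ∀ (p : Ideal B) [p.IsPrime],
      ringKrullDim (Localization.AtPrime p) = (edim (Localization.AtPrime p) : WithBot ℕ∞))
    (q : Ideal (K ⊗[R] B)) [q.IsPrime] :
    ringKrullDim (Localization.AtPrime q) = (edim (Localization.AtPrime q) : WithBot ℕ∞) := by
  let := (Algebra.TensorProduct.includeRight : B →ₐ[R] K ⊗[R] B).toRingHom.toAlgebra
  have : IsLocalization (Algebra.algebraMapSubmonoid B (nonZeroDivisors R)) (K ⊗[R] B) := by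
    have h0 : IsLocalization (Algebra.algebraMapSubmonoid B (nonZeroDivisors R)) (B ⊗[R] K) :=
      inferInstance
    let e : B ⊗[R] K ≃ₐ[B] K ⊗[R] B :=
      AlgEquiv.ofRingEquiv (f := (Algebra.TensorProduct.comm R B K).toRingEquiv) (fun r => by
        simp [Algebra.TensorProduct.algebraMap_apply]
        rfl)
    exact IsLocalization.isLocalization_of_algEquiv _ e
  have h1 := IsLocalization.isLocalization_isLocalization_atPrime_isLocalization
    (M := Algebra.algebraMapSubmonoid B (nonZeroDivisors R)) (Localization.AtPrime q) q
  have : IsNoetherianRing (Localization.AtPrime (q.under B)) :=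
    IsLocalization.isNoetherianRing (q.under B).primeCompl _ inferInstance
  let e := (IsLocalization.algEquiv (q.under B).primeCompl
    (Localization.AtPrime (q.under B)) (Localization.AtPrime q)).toRingEquiv
  rw [← ringKrullDim_eq_of_ringEquiv e, ← edim_eq_of_ringEquiv e]
  exact h _

noncomputable def stalkEquiv {A : CommRingCat.{0}} {Y : Scheme.{0}} (j : Spec A ⟶ Y)
    [IsOpenImmersion j] (P : PrimeSpectrum A) :
    Y.presheaf.stalk (j P) ≃+* Localization.AtPrime P.asIdeal :=
  have : IsIso (j.stalkMap (show Spec A from P)) := inferInstance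
  (asIso (j.stalkMap (show Spec A from P)) ≪≫ Spec.stalkIso A P).commRingCatIsoToRingEquiv

lemma cover {X S : Scheme.{0}} (R B K : Type) [CommRing R] [CommRing B] [CommRing K] [Algebra R B]
    [Algebra R K] (f : X ⟶ S) (g : Spec (.of K) ⟶ S) (ι : Spec (.of B) ⟶ X) [IsOpenImmersion ι]
    (i : Spec (.of R) ⟶ S) [Mono i]
    (h1 : Spec.map (CommRingCat.ofHom (algebraMap R B)) ≫ i = ι ≫ f)
    (h2 : Spec.map (CommRingCat.ofHom (algebraMap R K)) ≫ i = g) :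
    ∃ j : Spec (.of (K ⊗[R] B)) ⟶ pullback f g, IsOpenImmersion j ∧
      (∀ y, pullback.fst f g y ∈ Set.range ι → y ∈ Set.range j) ∧
      j ≫ pullback.snd f g = Spec.map (CommRingCat.ofHom (algebraMap K (K ⊗[R] B))) := by
  let fst : Spec (.of (K ⊗[R] B)) ⟶ Spec (.of B) :=
    Spec.map (CommRingCat.ofHom (Algebra.TensorProduct.includeRight : B →ₐ[R] K ⊗[R] B).toRingHom)
  let snd : Spec (.of (K ⊗[R] B)) ⟶ Spec (.of K) :=
    Spec.map (CommRingCat.ofHom (algebraMap K (K ⊗[R] B)))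
  have H1 : IsPullback snd fst (Spec.map (CommRingCat.ofHom (algebraMap R K)))
      (Spec.map (CommRingCat.ofHom (algebraMap R B))) :=
    isPullback_SpecMap_of_isPushout _ _ _ _ (CommRingCat.isPushout_tensorProduct R K B)
  have H2 : IsPullback fst snd (ι ≫ f) g := by
    have := H1.flip.paste_vert (IsPullback.of_vert_isIso_mono
      (snd := 𝟙 _) (f := i) (g := g) ⟨by rw [h2, Category.id_comp]⟩)
    rwa [h1, Category.comp_id] at this
  let j : Spec (.of (K ⊗[R] B)) ⟶ pullback f g :=
    pullback.lift (fst ≫ ι) snd (by simpa using H2.w)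
  have H3 : IsPullback fst j ι (pullback.fst f g) := by
    refine IsPullback.of_bot ?_ (pullback.lift_fst _ _ _).symm (IsPullback.of_hasPullback f g)
    rwa [show j ≫ pullback.snd f g = snd from pullback.lift_snd _ _ _]
  refine ⟨j, ?_, ?_, ?_⟩
  · exact MorphismProperty.of_isPullback H3 ‹_›
  · intro y ⟨b, hb⟩
    obtain ⟨z, hz1, hz2⟩ := Scheme.exists_preimage_of_isPullback H3 b y hb
    exact ⟨z, hz2⟩
  · exact pullback.lift_snd _ _ _


lemma stalk_eq {A : CommRingCat.{0}} {Y : Scheme.{0}} (j : Spec A ⟶ Y)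
    [IsOpenImmersion j] [IsNoetherianRing A] (P : PrimeSpectrum A) :
    ringKrullDim (Y.presheaf.stalk (j P)) = ringKrullDim (Localization.AtPrime P.asIdeal) ∧
    edim (Y.presheaf.stalk (j P)) = edim (Localization.AtPrime P.asIdeal) := by
  have : IsNoetherianRing (Localization.AtPrime P.asIdeal) :=
    IsLocalization.isNoetherianRing P.asIdeal.primeCompl _ inferInstance
  exact ⟨ringKrullDim_eq_of_ringEquiv (stalkEquiv j P),
    (edim_eq_of_ringEquiv (stalkEquiv j P).symm).symm⟩

lemma regular_affine (k : Type) [Field k] [PerfectField k] (X : Scheme.{0})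
    (fX : X ⟶ Spec (CommRingCat.of k)) (hX : SmoothOverField k X fX) (B : Type) [CommRing B]
    [Algebra k B] [Algebra.FiniteType k B] (ι : Spec (.of B) ⟶ X) [IsOpenImmersion ι]
    (h : ι ≫ fX = Spec.map (CommRingCat.ofHom (algebraMap k B))) (p : Ideal B) [p.IsPrime] :
    ringKrullDim (Localization.AtPrime p) = (edim (Localization.AtPrime p) : WithBot ℕ∞) := by
  apply regular_descend k (AlgebraicClosure k) B
  intro q hq
  obtain ⟨j, hj, -, -⟩ := cover k B (AlgebraicClosure k) fX
    (Spec.map (CommRingCat.ofHom (algebraMap k (AlgebraicClosure k)))) ι (𝟙 _)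
    (by rw [h, Category.comp_id]) (Category.comp_id _)
  have : IsNoetherianRing ((AlgebraicClosure k) ⊗[k] B) :=
    Algebra.FiniteType.isNoetherianRing (AlgebraicClosure k) _
  obtain ⟨h1, h2⟩ := stalk_eq j (⟨q, hq⟩ : PrimeSpectrum ((AlgebraicClosure k) ⊗[k] B))
  rw [← h1, ← h2]
  exact hX.2.2 _

lemma local_main
    (k : Type) [Field k] [PerfectField k]
    (X S : Scheme.{0})
    (fX : X ⟶ Spec (CommRingCat.of k)) (fS : S ⟶ Spec (CommRingCat.of k))
    [IsIntegral S] [LocallyOfFiniteType fX] [LocallyOfFiniteType fS]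
    (hX : SmoothOverField k X fX)
    (f : X ⟶ S) (hf : f ≫ fS = fX) (x : X) :
    ∃ (C : Type) (_ : CommRing C) (_ : Algebra (S.residueField (genericPoint S)) C)
      (j : Spec (.of C) ⟶ pullback f (S.fromSpecResidueField (genericPoint S))),
      IsOpenImmersion j ∧
      (∀ y, pullback.fst f (S.fromSpecResidueField (genericPoint S)) y = x → y ∈ Set.range j) ∧
      j ≫ pullback.snd f (S.fromSpecResidueField (genericPoint S)) =
        Spec.map (CommRingCat.ofHom (algebraMap (S.residueField (genericPoint S)) C)) ∧
      Algebra.FiniteType (S.residueField (genericPoint S)) C ∧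
      (∀ (p : Ideal C) [p.IsPrime],
        ringKrullDim (Localization.AtPrime p) = (edim (Localization.AtPrime p) : WithBot ℕ∞)) ∧
      ∀ (L : Type) [Field L] [Algebra (S.residueField (genericPoint S)) L]
        [Algebra.IsAlgebraic (S.residueField (genericPoint S)) L] [PerfectField L]
        (q : Ideal (L ⊗[S.residueField (genericPoint S)] C)) [q.IsPrime],
        (edim (Localization.AtPrime q) : WithBot ℕ∞) ≤
          ringKrullDim (Localization.AtPrime q) + topologicalKrullDim S := by
  obtain ⟨U, hU, hxU, -⟩ := exists_isAffineOpen_mem_and_subset (x := f x) (U := ⊤) trivial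
  obtain ⟨V, hV, hxV, hVU⟩ := exists_isAffineOpen_mem_and_subset (x := x) (U := f ⁻¹ᵁ U) hxU
  have : Nonempty U := ⟨⟨_, hxU⟩⟩
  have hξ : genericPoint S ∈ U := ((genericPoint_spec S).mem_open_set_iff U.isOpen).mpr (by
    rw [Set.univ_inter]
    exact ⟨_, hxU⟩)
  let R := Γ(S, U)
  let B := Γ(X, V)
  let K := S.residueField (genericPoint S)
  let : Algebra R B := (f.appLE U V hVU).hom.toAlgebra
  let : Algebra R K := (S.evaluation U (genericPoint S) hξ).hom.toAlgebra
  let φ : CommRingCat.of k ⟶ R := Spec.preimage (hU.fromSpec ≫ fS)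
  have hφ : Spec.map φ = hU.fromSpec ≫ fS := Spec.map_preimage _
  let : Algebra k R := φ.hom.toAlgebra
  let : Algebra k B := ((algebraMap R B).comp (algebraMap k R)).toAlgebra
  let : Algebra k K := ((algebraMap R K).comp (algebraMap k R)).toAlgebra
  have : IsScalarTower k R B := .of_algebraMap_eq' rfl
  have : IsScalarTower k R K := .of_algebraMap_eq' rfl
  have h1 : Spec.map (CommRingCat.ofHom (algebraMap R B)) ≫ hU.fromSpec = hV.fromSpec ≫ f :=
    IsAffineOpen.SpecMap_appLE_fromSpec f hU hV hVU
  have h2 : Spec.map (CommRingCat.ofHom (algebraMap R K)) ≫ hU.fromSpec =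
      S.fromSpecResidueField (genericPoint S) := by
    change Spec.map (S.presheaf.germ U _ hξ ≫ S.residue _) ≫ _ = _
    rw [Spec.map_comp, Category.assoc]
    change _ ≫ hU.fromSpecStalk hξ = _
    rw [hU.fromSpecStalk_eq_fromSpecStalk]
    rfl
  have h3 : hV.fromSpec ≫ fX = Spec.map (CommRingCat.ofHom (algebraMap k B)) := by
    change _ = Spec.map (φ ≫ CommRingCat.ofHom (algebraMap R B))
    rw [Spec.map_comp, hφ, reassoc_of% h1, hf]
  have hR : Algebra.FiniteType k R := by
    have : LocallyOfFiniteType (Spec.map φ) := by rw [hφ]; infer_instance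
    exact (HasRingHomProperty.Spec_iff (P := @LocallyOfFiniteType)).mp this
  have hB : Algebra.FiniteType k B := by
    have : LocallyOfFiniteType (Spec.map (CommRingCat.ofHom (algebraMap k B))) := by
      rw [← h3]; infer_instance
    exact (HasRingHomProperty.Spec_iff (P := @LocallyOfFiniteType)).mp this
  have hBR : Algebra.FiniteType R B := .of_restrictScalars_finiteType k R B
  have hBN : IsNoetherianRing B := Algebra.FiniteType.isNoetherianRing k B
  have : IsFractionRing R K := by
    have h0 := functionField_isFractionRing_of_isAffineOpen S U hU
    let e : S.functionField ≃ₐ[R] K := AlgEquiv.ofBijective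
      { (S.residue (genericPoint S)).hom with commutes' := fun r => rfl }
      ⟨RingHom.injective (S.residue (genericPoint S)).hom, S.residue_surjective _⟩
    exact IsLocalization.isLocalization_of_algEquiv _ e
  have hreg := regular_affine k X fX hX B hV.fromSpec h3
  let fK : Field K := inferInstance
  obtain ⟨j, hj1, hj2, hj3⟩ := @cover X S R B K _ _ fK.toCommRing _ _ f
    (S.fromSpecResidueField (genericPoint S))
    hV.fromSpec _ hU.fromSpec _ h1 h2
  have hreg' := generic_loc R K B hreg
  refine ⟨K ⊗[R] B, inferInstance, inferInstance, j, hj1, ?_, hj3, ?_, ?_, ?_⟩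
  · rintro y rfl
    refine hj2 y ?_
    rw [hV.range_fromSpec]
    exact hxV
  · exact Algebra.FiniteType.baseChange K
  · exact hreg'
  · intro L _ _ _ _ q _
    obtain ⟨s, hs, hs'⟩ := trdeg_le_ringKrullDim k R K
    have : Algebra.EssFiniteType R K := .of_isLocalization _ (nonZeroDivisors R)
    have : Algebra.EssFiniteType k K := .comp k R K
    refine (edim_le_main k K L (K ⊗[R] B) s hs hreg' q).trans ?_
    gcongr
    refine hs'.trans ?_
    rw [← PrimeSpectrum.topologicalKrullDim_eq_ringKrullDim]
    exact Topology.IsInducing.topologicalKrullDim_le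
      (Scheme.Hom.isOpenEmbedding hU.fromSpec).isInducing

end GGF

/-- **Theorem 1.2.** Let `f : X ⟶ S` be a morphism of smooth varieties over a
perfect field `k`.  Then the generic fiber `X_ξ` over the generic point `ξ` of `S` is regular,
and every point `x̄` of the geometric generic fiber `X̄_ξ = X_ξ ×_κ(ξ) κ̄(ξ)` satisfies
`edim 𝒪_{X̄_ξ,x̄} ≤ dim 𝒪_{X̄_ξ,x̄} + dim S`, i.e. the embedding codimension of `x̄` is at
most `dim S`. -/
theorem edim_stalk_geometric_generic_fiber_le
    (k : Type) [Field k] [PerfectField k]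
    (X S : Scheme)
    (fX : X ⟶ Spec (CommRingCat.of k)) (fS : S ⟶ Spec (CommRingCat.of k))
    [IsIntegral X] [IsIntegral S]
    [IsSeparated fX] [IsSeparated fS]
    [LocallyOfFiniteType fX] [LocallyOfFiniteType fS]
    [QuasiCompact fX] [QuasiCompact fS]
    (hX : SmoothOverField k X fX) (hS : SmoothOverField k S fS)
    (f : X ⟶ S) (hf : f ≫ fS = fX) :
    SchemeRegular (pullback f (S.fromSpecResidueField (genericPoint S))) ∧
    ∀ xbar : ↥(pullback
        (pullback.snd f (S.fromSpecResidueField (genericPoint S)))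
        (Spec.map (CommRingCat.ofHom (algebraMap (S.residueField (genericPoint S))
          (AlgebraicClosure (S.residueField (genericPoint S))))))),
      (edim ((pullback
          (pullback.snd f (S.fromSpecResidueField (genericPoint S)))
          (Spec.map (CommRingCat.ofHom (algebraMap (S.residueField (genericPoint S))
            (AlgebraicClosure (S.residueField (genericPoint S))))))).presheaf.stalk xbar) :
          WithBot (WithTop ℕ)) ≤
        ringKrullDim ((pullback
          (pullback.snd f (S.fromSpecResidueField (genericPoint S)))
          (Spec.map (CommRingCat.ofHom (algebraMap (S.residueField (genericPoint S))
            (AlgebraicClosure (S.residueField (genericPoint S))))))).presheaf.stalk xbar) +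
          (show WithBot ℕ∞ from topologicalKrullDim ↥S) := by
  have : LocallyOfFiniteType f := by
    have : LocallyOfFiniteType (f ≫ fS) := by rw [hf]; infer_instance
    exact locallyOfFiniteType_of_comp f fS
  have hN : IsLocallyNoetherian (Spec (S.residueField (genericPoint S))) := by
    have : IsNoetherianRing (S.residueField (genericPoint S)) :=
      inferInstanceAs (IsNoetherianRing (ResidueField (S.presheaf.stalk (genericPoint S))))
    infer_instance
  refine ⟨⟨?_, ?_⟩, ?_⟩
  · exact LocallyOfFiniteType.isLocallyNoetherian
      (pullback.snd f (S.fromSpecResidueField (genericPoint S)))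
  · intro y
    obtain ⟨C, _, _, j, hj, hj2, hj3, hC, hreg, -⟩ := GGF.local_main k X S fX fS hX f hf
      (pullback.fst f (S.fromSpecResidueField (genericPoint S)) y)
    obtain ⟨P, rfl⟩ := hj2 y rfl
    have : IsNoetherianRing C :=
      Algebra.FiniteType.isNoetherianRing (S.residueField (genericPoint S)) C
    obtain ⟨h1, h2⟩ := GGF.stalk_eq j P
    rw [h1, h2]
    exact @hreg _ (PrimeSpectrum.isPrime P)
  · intro y
    obtain ⟨C, _, _, j, hj, hj2, hj3, hC, -, hle⟩ := GGF.local_main k X S fX fS hX f hf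
      (pullback.fst f (S.fromSpecResidueField (genericPoint S))
        (pullback.fst (pullback.snd f (S.fromSpecResidueField (genericPoint S)))
        (Spec.map (CommRingCat.ofHom (algebraMap (S.residueField (genericPoint S))
          (AlgebraicClosure (S.residueField (genericPoint S)))))) y))
    let fK : Field (S.residueField (genericPoint S)) := inferInstance
    obtain ⟨J, hJ, hJ2, -⟩ := @GGF.cover _ _ (S.residueField (genericPoint S)) C
      (AlgebraicClosure (S.residueField (genericPoint S))) fK.toCommRing _ _ _ _
      (pullback.snd f (S.fromSpecResidueField (genericPoint S)))
      (Spec.map (CommRingCat.ofHom (algebraMap (S.residueField (genericPoint S))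
          (AlgebraicClosure (S.residueField (genericPoint S))))))
      j _ (𝟙 _) _ (by rw [hj3]; exact Category.comp_id _) (Category.comp_id _)
    obtain ⟨P, rfl⟩ := hJ2 y (hj2 _ rfl)
    have : IsNoetherianRing (TensorProduct (S.residueField (genericPoint S))
        (AlgebraicClosure (S.residueField (genericPoint S))) C) :=
      Algebra.FiniteType.isNoetherianRing (AlgebraicClosure (S.residueField (genericPoint S))) _
    obtain ⟨h1, h2⟩ := GGF.stalk_eq J P
    rw [h1, h2]
    exact @hle (AlgebraicClosure (S.residueField (genericPoint S))) _ _ _ _ _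
      (PrimeSpectrum.isPrime P)
end

section
/- Let k be a field of characteristic p > 0, let t ∈ k \ k^p, and let K/k be a field extension. Suppose m := max{j ∈ ℕ : t has a p^j-th root in K} exists, let s ∈ K be the unique p^m-th root of t in K, and let n > m. Set L := K[Z]/(Z^{p^{n−m}} − s), a field (since s ∉ K^p). Then there is an isomorphism of rings K ⊗_k (k[Y]/(Y^{p^n} − t)) ≅ L[X]/(X^{p^m}). In particular, K ⊗_k k(t^{1/p^n}) is an Artin local ring with residue field L = K(t^{1/p^n}) and maximal ideal generated by one element. -/
set_option maxSynthPendingDepth 3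

open TensorProduct Polynomial

theorem aux_irr (p : ℕ) [Fact p.Prime] {F : Type*} [Field F] [CharP F p] (n : ℕ) (a : F)
    (ha : ∀ b : F, b ^ p ≠ a) : Irreducible (X ^ p ^ n - C a : F[X]) := by
  have hp : p.Prime := Fact.out
  have : ExpChar F p := ExpChar.prime hp
  obtain ⟨α, hα⟩ := IsAlgClosed.exists_pow_nat_eq (algebraMap F (AlgebraicClosure F) a)
    (pow_pos hp.pos n)
  have h1 := (minpoly.natSepDegree_eq_one_iff_pow_mem p (F := F) (x := α)).2 ⟨n, a, hα.symm⟩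
  obtain ⟨r, y, hr⟩ := (minpoly.natSepDegree_eq_one_iff_eq_X_pow_sub_C p).1 h1
  have hint : IsIntegral F α := Algebra.IsIntegral.isIntegral α
  have hy : α ^ p ^ r = algebraMap F _ y := by
    have := minpoly.aeval F α
    rw [hr] at this
    simpa [sub_eq_zero] using this
  have hdvd : minpoly F α ∣ X ^ p ^ n - C a := minpoly.dvd _ _ (by simp [hα])
  have hle := natDegree_le_of_dvd hdvd (X_pow_sub_C_ne_zero (pow_pos hp.pos n) a)
  rw [hr, natDegree_X_pow_sub_C, natDegree_X_pow_sub_C] at hle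
  have hrn : r ≤ n := (Nat.pow_le_pow_iff_right hp.one_lt).1 hle
  have hya : y ^ p ^ (n - r) = a := by
    apply (algebraMap F (AlgebraicClosure F)).injective
    rw [map_pow, ← hy, ← pow_mul, ← pow_add, Nat.add_sub_cancel' hrn, hα]
  rcases hrn.lt_or_eq with h | h
  · exfalso
    apply ha (y ^ p ^ (n - r - 1))
    rw [← pow_mul, ← pow_succ, show n - r - 1 + 1 = n - r by omega, hya]
  · subst h
    have : y = a := by simpa using hya
    subst this
    rw [← hr]
    exact minpoly.irreducible hint

theorem aux_step (p : ℕ) [Fact p.Prime] {E : Type*} [Field E] [CharP E p] (c : E)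
    (hc : ∀ b : E, b ^ p ≠ c) :
    ∃ F : Subfield E, c ∉ F ∧ (∀ x : E, x ^ p ∈ F) ∧ ∀ G : Subfield E, F ≤ G → c ∈ G → G = ⊤ := by
  have hp : p.Prime := Fact.out
  have : ExpChar E p := ExpChar.prime hp
  obtain ⟨F, hF0, hF⟩ := zorn_le_nonempty₀ {F : Subfield E | c ∉ F ∧ ∀ x : E, x ^ p ∈ F}
    (by
      intro S hS hchain y hy
      refine ⟨sSup S, ⟨?_, fun x => ?_⟩, fun z hz => le_sSup hz⟩
      · rw [Subfield.mem_sSup_of_directedOn ⟨y, hy⟩ hchain.directedOn]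
        rintro ⟨G, hG, hcG⟩
        exact (hS hG).1 hcG
      · exact (le_sSup hy : y ≤ sSup S) ((hS hy).2 x))
    (frobenius E p).fieldRange
    ⟨by rintro ⟨b, hb⟩; exact hc b hb, fun x => ⟨x, rfl⟩⟩
  obtain ⟨hcF, hpF⟩ := hF.prop
  refine ⟨F, hcF, hpF, fun G hFG hcG => ?_⟩
  have hdeg : ∀ x : E, x ∉ F → Module.finrank F (IntermediateField.adjoin F {x}) = p := by
    intro x hx
    have hirr : Irreducible (X ^ p - C (⟨x ^ p, hpF x⟩ : F)) := by
      apply X_pow_sub_C_irreducible_of_prime hp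
      intro b hb
      apply hx
      have : (b : E) ^ p = x ^ p := congrArg Subtype.val hb
      have := frobenius_inj E p this
      rw [← this]; exact b.2
    have hroot : aeval x (X ^ p - C (⟨x ^ p, hpF x⟩ : F)) = 0 := by
      simp [sub_eq_zero]; rfl
    have hmonic : (X ^ p - C (⟨x ^ p, hpF x⟩ : F)).Monic := monic_X_pow_sub_C _ hp.ne_zero
    rw [IntermediateField.adjoin.finrank ⟨_, hmonic, by simpa [aeval_def] using hroot⟩,
      ← minpoly.eq_of_irreducible_of_monic hirr hroot hmonic, natDegree_X_pow_sub_C]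
  rw [eq_top_iff]
  rintro x -
  by_cases hx : x ∈ F
  · exact hFG hx
  have hle : F ≤ (IntermediateField.adjoin F {x}).toSubfield := fun y hy =>
    (IntermediateField.adjoin F {x}).algebraMap_mem ⟨y, hy⟩
  have hcx : c ∈ IntermediateField.adjoin F {x} := by
    by_contra hcx
    have := hF.le_of_ge (y := (IntermediateField.adjoin F {x}).toSubfield)
      ⟨hcx, fun z => hle (hpF z)⟩ hle
    exact hx (this (IntermediateField.mem_adjoin_simple_self F x))
  have hfd : FiniteDimensional F (IntermediateField.adjoin F {x}) :=
    Module.finite_of_finrank_pos (by rw [hdeg x hx]; exact hp.pos)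
  have heq := IntermediateField.eq_of_le_of_finrank_eq (F := IntermediateField.adjoin F {c})
    (E := IntermediateField.adjoin F {x})
    (by rw [IntermediateField.adjoin_simple_le_iff]; exact hcx) (by rw [hdeg x hx, hdeg c hcF])
  have hx' : x ∈ IntermediateField.adjoin F {c} := by
    rw [heq]; exact IntermediateField.mem_adjoin_simple_self F x
  let G' : IntermediateField F E := G.toIntermediateField (fun y => hFG y.2)
  have : IntermediateField.adjoin F {c} ≤ G' := by
    rw [IntermediateField.adjoin_simple_le_iff]; exact hcG
  exact this hx'

theorem aux_iter (p : ℕ) [Fact p.Prime] {E : Type*} [Field E] [CharP E p] (s : E)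
    (hs : ∀ b : E, b ^ p ≠ s) (m : ℕ) :
    ∃ (F : Subfield E) (c : F), (c : E) = s ^ p ^ m ∧ (∀ u : F, u ^ p ≠ c) ∧
      ∀ G : Subfield E, F ≤ G → s ∈ G → G = ⊤ := by
  have hp : p.Prime := Fact.out
  induction m with
  | zero =>
    refine ⟨⊤, ⟨s, trivial⟩, by simp, fun u hu => hs u (congrArg Subtype.val hu), ?_⟩
    intro G hG _
    exact top_le_iff.1 hG
  | succ m ih =>
    obtain ⟨F, c, hc, hcp, hG⟩ := ih
    have : ExpChar F p := ExpChar.prime hp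
    obtain ⟨F', hcF, hpF, hG'⟩ := aux_step p c hcp
    refine ⟨F'.map F.subtype, ⟨(c ^ p : F), ⟨c ^ p, hpF c, rfl⟩⟩, ?_, ?_, ?_⟩
    · simp [hc, pow_succ, pow_mul]
    · rintro ⟨_, u, hu, rfl⟩ h
      apply hcF
      have h1 : u ^ p = c ^ p := Subtype.ext (by simpa using congrArg Subtype.val h)
      rw [← frobenius_inj F p h1]
      exact hu
    · intro G hFG hsG
      apply hG G _ hsG
      have h2 : G.comap F.subtype = ⊤ := by
        apply hG'
        · intro x hx; exact hFG ⟨x, hx, rfl⟩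
        · change (c : E) ∈ G
          rw [hc]; exact pow_mem hsG _
      intro x hx
      have : (⟨x, hx⟩ : F) ∈ G.comap F.subtype := by rw [h2]; trivial
      exact this

theorem aux_base {R T : Type*} [CommRing R] [CommRing T] [Algebra R T] (f : R[X]) :
    Nonempty (T ⊗[R] AdjoinRoot f ≃+* AdjoinRoot (f.map (algebraMap R T))) := by
  refine ⟨(AdjoinRoot.tensorAlgEquiv (R := R) (T := T) f _ rfl).toRingEquiv.trans
    (AdjoinRoot.mapRingEquiv (Algebra.TensorProduct.rid R R T).toRingEquiv _ _ ?_)⟩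
  rw [Polynomial.map_map]
  have : (((Algebra.TensorProduct.rid R R T).toRingEquiv : T ⊗[R] R →+* T)).comp
      (Algebra.TensorProduct.includeRight : R →ₐ[R] T ⊗[R] R).toRingHom = algebraMap R T := by
    ext x
    simp [Algebra.algebraMap_eq_smul_one]
  exact Associated.of_eq (by rw [← this])

theorem aux_gen {F M : Type*} [Field F] [CommRing M] [Nontrivial M] [Algebra F M] (z : M)
    (f : F[X]) (hf : Irreducible f) (hz : aeval z f = 0) (hgen : Algebra.adjoin F {z} = ⊤) :
    Nonempty (AdjoinRoot f ≃ₐ[F] M) := by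
  have := Fact.mk hf
  let φ : AdjoinRoot f →ₐ[F] M := AdjoinRoot.liftAlgHom f (Algebra.ofId F M) z hz
  refine ⟨AlgEquiv.ofBijective φ ⟨φ.toRingHom.injective, ?_⟩⟩
  rw [← AlgHom.range_eq_top, ← top_le_iff, ← hgen, Algebra.adjoin_le_iff]
  rintro _ rfl
  exact ⟨AdjoinRoot.root f, AdjoinRoot.lift_root hz⟩

theorem aux_shift {L : Type*} [CommRing L] (q : ℕ) (w c : L)
    (h : (X ^ q - C c : L[X]) = (X - C w) ^ q) :
    Nonempty (AdjoinRoot (X ^ q - C c : L[X]) ≃+* AdjoinRoot (X ^ q : L[X])) := by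
  refine ⟨Ideal.quotientEquiv _ _ (Polynomial.algEquivAevalXAddC w).toRingEquiv ?_⟩
  rw [Ideal.map_span, Set.image_singleton, h]
  simp

theorem aux_iso (p : ℕ) [Fact p.Prime] {F K : Type*} [Field F] [Field K] [Algebra F K]
    [CharP F p] [CharP K p] (m n : ℕ) (hmn : m < n) (s : K) (hmax : ∀ u : K, u ^ p ≠ s)
    (c : F) (hc : algebraMap F K c = s ^ p ^ m) (hcp : ∀ u : F, u ^ p ≠ c)
    (hgen : Algebra.adjoin F {s} = ⊤) :
    Nonempty (AdjoinRoot (X ^ p ^ n - C (s ^ p ^ m) : K[X]) ≃+*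
      AdjoinRoot (X ^ p ^ m : (AdjoinRoot (X ^ p ^ (n - m) - C s : K[X]))[X])) := by
  have hp : p.Prime := Fact.out
  have := Fact.mk (aux_irr p (n - m) s hmax)
  let L := AdjoinRoot (X ^ p ^ (n - m) - C s : K[X])
  let z : L := AdjoinRoot.root _
  have : CharP L p := charP_of_injective_algebraMap (algebraMap K L).injective p
  have : ExpChar L p := ExpChar.prime hp
  have hz : z ^ p ^ (n - m) = algebraMap K L s := by
    have := AdjoinRoot.eval₂_root (X ^ p ^ (n - m) - C s : K[X])
    simp only [eval₂_sub, eval₂_X_pow, eval₂_C, sub_eq_zero] at this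
    exact this
  have hcL : algebraMap F L c = algebraMap K L s ^ p ^ m := by
    rw [IsScalarTower.algebraMap_apply F K L, hc, map_pow]
  obtain ⟨e1⟩ := aux_gen s (X ^ p ^ m - C c : F[X]) (aux_irr p m c hcp) (by simp [hc]) hgen
  have hgen2 : Algebra.adjoin F {z} = ⊤ := by
    have hzm : z ∈ Algebra.adjoin F {z} := Algebra.subset_adjoin rfl
    have hK : ∀ x : K, algebraMap K L x ∈ Algebra.adjoin F {z} := by
      have : (⊤ : Subalgebra F K) ≤
          (Algebra.adjoin F {z}).comap (IsScalarTower.toAlgHom F K L) := by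
        rw [← hgen, Algebra.adjoin_le_iff]
        rw [Set.singleton_subset_iff]
        change algebraMap K L s ∈ Algebra.adjoin F {z}
        rw [← hz]
        exact pow_mem hzm _
      exact fun x => this (Algebra.mem_top (x := x))
    rw [eq_top_iff]
    rintro x -
    obtain ⟨g, rfl⟩ := AdjoinRoot.mk_surjective x
    induction g using Polynomial.induction_on' with
    | add a b ha hb => rw [map_add]; exact add_mem ha hb
    | monomial i a =>
      rw [← C_mul_X_pow_eq_monomial, map_mul, map_pow, AdjoinRoot.mk_X, AdjoinRoot.mk_C]
      exact mul_mem (hK a) (pow_mem hzm _)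
  obtain ⟨e2⟩ := aux_gen z (X ^ p ^ n - C c : F[X]) (aux_irr p n c hcp) (by
    have : p ^ n = p ^ (n - m) * p ^ m := by rw [← pow_add, Nat.sub_add_cancel hmn.le]
    simp [this, pow_mul, hz, hcL]) hgen2
  obtain ⟨b1⟩ := aux_base (T := K) (X ^ p ^ n - C c : F[X])
  obtain ⟨b2⟩ := aux_base (T := L) (X ^ p ^ m - C c : F[X])
  have h1 : (X ^ p ^ n - C c : F[X]).map (algebraMap F K) = X ^ p ^ n - C (s ^ p ^ m) := by
    simp only [Polynomial.map_sub, Polynomial.map_pow, Polynomial.map_X, Polynomial.map_C, hc]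
  have h2 : (X ^ p ^ m - C c : F[X]).map (algebraMap F L) =
      X ^ p ^ m - C (algebraMap F L c) := by
    simp only [Polynomial.map_sub, Polynomial.map_pow, Polynomial.map_X, Polynomial.map_C]
  rw [h1] at b1
  rw [h2] at b2
  obtain ⟨e3⟩ := aux_shift (p ^ m) (algebraMap K L s) (algebraMap F L c) (by
    rw [sub_pow_expChar_pow, hcL, C_pow])
  exact ⟨b1.symm.trans (((Algebra.TensorProduct.congr AlgEquiv.refl e2).trans
    ((Algebra.TensorProduct.comm F K L).trans
      (Algebra.TensorProduct.congr AlgEquiv.refl e1.symm))).toRingEquiv.trans (b2.trans e3))⟩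

theorem aux_iso' (p : ℕ) [Fact p.Prime] {K : Type*} [Field K]
    [CharP K p] (m n : ℕ) (hmn : m < n) (s : K) (hmax : ∀ u : K, u ^ p ≠ s) :
    Nonempty (AdjoinRoot (X ^ p ^ n - C (s ^ p ^ m) : K[X]) ≃+*
      AdjoinRoot (X ^ p ^ m : (AdjoinRoot (X ^ p ^ (n - m) - C s : K[X]))[X])) := by
  have hp : p.Prime := Fact.out
  obtain ⟨F, c, hc, hcp, hG⟩ := aux_iter p s hmax m
  refine aux_iso (F := F) p m n hmn s hmax c hc hcp ?_
  have hint : IsAlgebraic F s := by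
    refine ⟨X ^ p ^ m - C c, X_pow_sub_C_ne_zero (pow_pos hp.pos m) c, ?_⟩
    simp only [map_sub, map_pow, aeval_X, aeval_C, ← hc]
    exact sub_self _
  rw [← IntermediateField.adjoin_simple_toSubalgebra_of_isAlgebraic hint]
  have := hG (IntermediateField.adjoin F {s}).toSubfield
    (fun y hy => (IntermediateField.adjoin F {s}).algebraMap_mem ⟨y, hy⟩)
    (IntermediateField.mem_adjoin_simple_self F s)
  rw [eq_top_iff]
  rintro x -
  have hx : x ∈ (IntermediateField.adjoin F {s}).toSubfield := by rw [this]; trivial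
  exact hx

theorem aux_local {R L : Type*} [CommRing R] [CommRing L] (hL : IsField L) (φ : R →+* L)
    (hφ : Function.Surjective φ) (a : R) (hker : RingHom.ker φ = Ideal.span {a})
    (ha : IsNilpotent a) :
    IsLocalRing R ∧ ∃ a : R, ∀ M : Ideal R, M.IsMaximal → M = Ideal.span {a} ∧
      Nonempty ((R ⧸ M) ≃+* L) := by
  let e := RingHom.quotientKerEquivOfSurjective hφ
  have hmax : (Ideal.span {a}).IsMaximal := by
    rw [← hker]
    exact Ideal.Quotient.maximal_of_isField _ (e.toMulEquiv.isField hL)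
  have huniq : ∀ M : Ideal R, M.IsMaximal → M = Ideal.span {a} := by
    intro M hM
    refine (hmax.eq_of_le hM.ne_top ?_).symm
    rw [Ideal.span_singleton_le_iff_mem]
    obtain ⟨n, hn⟩ := ha
    exact hM.isPrime.mem_of_pow_mem n (by rw [hn]; exact M.zero_mem)
  refine ⟨IsLocalRing.of_unique_max_ideal ⟨_, hmax, huniq⟩, a, fun M hM => ⟨huniq M hM, ?_⟩⟩
  rw [huniq M hM, ← hker]
  exact ⟨e⟩

theorem aux_trunc {L : Type*} [CommRing L] (q : ℕ) (hq : q ≠ 0) :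
    ∃ φ : AdjoinRoot (X ^ q : L[X]) →+* L, Function.Surjective φ ∧
      RingHom.ker φ = Ideal.span {AdjoinRoot.root (X ^ q : L[X])} := by
  let φ : AdjoinRoot (X ^ q : L[X]) →+* L := AdjoinRoot.lift (RingHom.id L) 0 (by simp [hq])
  refine ⟨φ, fun x => ⟨AdjoinRoot.of _ x, by simp [φ]⟩, le_antisymm ?_ ?_⟩
  · intro x hx
    obtain ⟨g, rfl⟩ := AdjoinRoot.mk_surjective x
    have hg : g.coeff 0 = 0 := by
      have : φ (AdjoinRoot.mk _ g) = 0 := hx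
      simp only [φ, AdjoinRoot.lift_mk, eval₂_id] at this
      rwa [coeff_zero_eq_eval_zero]
    obtain ⟨h, rfl⟩ := X_dvd_iff.2 hg
    rw [Ideal.mem_span_singleton, map_mul, AdjoinRoot.mk_X]
    exact dvd_mul_right _ _
  · rw [Ideal.span_singleton_le_iff_mem, RingHom.mem_ker]
    simp [φ]

theorem aux_main (p : ℕ) [Fact p.Prime]
    (k : Type) [Field k] [CharP k p] (t : k) 
    (K : Type) [Field K] [Algebra k K] (m n : ℕ) (hmn : m < n)
    (s : K) (hs : s ^ p ^ m = algebraMap k K t) (hmax : ∀ u : K, u ^ p ≠ s) :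
    Nonempty ((K ⊗[k] AdjoinRoot (X ^ p ^ n - C t : k[X])) ≃+*
      AdjoinRoot (X ^ p ^ m : (AdjoinRoot (X ^ p ^ (n - m) - C s : K[X]))[X])) ∧
    IsLocalRing (K ⊗[k] AdjoinRoot (X ^ p ^ n - C t : k[X])) ∧
    IsArtinianRing (K ⊗[k] AdjoinRoot (X ^ p ^ n - C t : k[X])) ∧
    ∃ a : (K ⊗[k] AdjoinRoot (X ^ p ^ n - C t : k[X])),
      ∀ M : Ideal (K ⊗[k] AdjoinRoot (X ^ p ^ n - C t : k[X])),
        M.IsMaximal → M = Ideal.span {a} ∧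
          Nonempty (((K ⊗[k] AdjoinRoot (X ^ p ^ n - C t : k[X])) ⧸ M) ≃+*
            AdjoinRoot (X ^ p ^ (n - m) - C s : K[X])) := by
  have hp : p.Prime := Fact.out
  have : CharP K p := charP_of_injective_algebraMap (algebraMap k K).injective p
  obtain ⟨b⟩ := aux_base (T := K) (X ^ p ^ n - C t : k[X])
  have h1 : (X ^ p ^ n - C t : k[X]).map (algebraMap k K) = X ^ p ^ n - C (s ^ p ^ m) := by
    simp only [Polynomial.map_sub, Polynomial.map_pow, Polynomial.map_X, Polynomial.map_C, hs]
  rw [h1] at b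
  obtain ⟨e'⟩ := aux_iso' p m n hmn s hmax
  let e := b.trans e'
  have := Fact.mk (aux_irr p (n - m) s hmax)
  obtain ⟨φ, hφ, hker⟩ := aux_trunc (L := AdjoinRoot (X ^ p ^ (n - m) - C s : K[X])) (p ^ m)
    (pow_ne_zero _ hp.ne_zero)
  obtain ⟨hl, ha⟩ := aux_local (Field.toIsField (AdjoinRoot (X ^ p ^ (n - m) - C s : K[X])))
    (φ.comp (e : _ →+* _)) (hφ.comp e.surjective) (e.symm (AdjoinRoot.root _)) (by
      ext x
      rw [RingHom.mem_ker, RingHom.comp_apply, ← RingHom.mem_ker, hker,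
        Ideal.mem_span_singleton, Ideal.mem_span_singleton, ← map_dvd_iff e]
      simp) ⟨p ^ m, by
        rw [← map_pow, ← AdjoinRoot.mk_X, ← map_pow, AdjoinRoot.mk_self, map_zero]⟩
  refine ⟨⟨e⟩, hl, ?_, ha⟩
  have : Module.Finite k (AdjoinRoot (X ^ p ^ n - C t : k[X])) :=
    (monic_X_pow_sub_C t (pow_ne_zero _ hp.ne_zero)).finite_adjoinRoot
  exact IsArtinianRing.of_finite K _

/-- **Lemma 8.2, second case.** Let `t ∈ k \ kᵖ`, let `K/k` be a field extension,
let `m` be maximal such that `t` has a `p^m`-th root `s` in `K` (so `s` has no `p`-th root in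
`K`), and let `n > m`.  With `L := K[Z]/(Z^{p^{n−m}} − s) = K(t^{1/pⁿ})`, there is a ring
isomorphism `K ⊗_k (k[Y]/(Y^{pⁿ} − t)) ≅ L[X]/(X^{p^m})`; in particular `K ⊗_k k(t^{1/pⁿ})`
is an Artin local ring with residue field `L` and principal maximal ideal. -/
theorem tensor_adjoin_root_equiv_of_root_not_mem
    (p : ℕ) [Fact p.Prime]
    (k : Type) [Field k] [CharP k p]
    (t : k) (ht : ∀ c : k, c ^ p ≠ t)
    (K : Type) [Field K] [Algebra k K]
    (m n : ℕ) (hmn : m < n)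
    (s : K) (hs : s ^ p ^ m = algebraMap k K t)
    (hmax : ∀ u : K, u ^ p ≠ s) :
    Nonempty ((K ⊗[k] (Polynomial k ⧸
          Ideal.span {(Polynomial.X : Polynomial k) ^ p ^ n - Polynomial.C t})) ≃+*
        (Polynomial (Polynomial K ⧸
            Ideal.span {(Polynomial.X : Polynomial K) ^ p ^ (n - m) - Polynomial.C s}) ⧸
          Ideal.span {(Polynomial.X : Polynomial (Polynomial K ⧸
            Ideal.span {(Polynomial.X : Polynomial K) ^ p ^ (n - m) - Polynomial.C s})) ^
              p ^ m})) ∧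
    IsLocalRing (K ⊗[k] (Polynomial k ⧸
        Ideal.span {(Polynomial.X : Polynomial k) ^ p ^ n - Polynomial.C t})) ∧
    IsArtinianRing (K ⊗[k] (Polynomial k ⧸
        Ideal.span {(Polynomial.X : Polynomial k) ^ p ^ n - Polynomial.C t})) ∧
    ∃ a : (K ⊗[k] (Polynomial k ⧸
        Ideal.span {(Polynomial.X : Polynomial k) ^ p ^ n - Polynomial.C t})),
      ∀ M : Ideal (K ⊗[k] (Polynomial k ⧸
          Ideal.span {(Polynomial.X : Polynomial k) ^ p ^ n - Polynomial.C t})),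
        M.IsMaximal → M = Ideal.span {a} ∧
          Nonempty (((K ⊗[k] (Polynomial k ⧸
              Ideal.span {(Polynomial.X : Polynomial k) ^ p ^ n - Polynomial.C t})) ⧸ M) ≃+*
            (Polynomial K ⧸
              Ideal.span {(Polynomial.X : Polynomial K) ^ p ^ (n - m) - Polynomial.C s})) := by
  exact aux_main p k t K m n hmn s hs hmax
end

section
/- Let F be a perfect field of characteristic p > 0 and let K be a finitely generated field extension of F. Then pdeg(K/F) = trdeg(K/F); that is, the rank of the K-vector space of Kähler differentials Ω_{K/F} equals the transcendence degree of K over F. -/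
open TensorProduct IntermediateField.algebraAdjoinAdjoin in
lemma rank_kaehler_aux (F K : Type) [Field F] [Field K] [Algebra F K]
    {ι : Type} (v : ι → K) (hb : AlgebraicIndependent F v)
    [Algebra.IsSeparable (IntermediateField.adjoin F (Set.range v)) K] :
    Module.rank K (Ω[K⁄F]) = Cardinal.mk ι := by
  have h1 : Algebra.FormallyEtale (Algebra.adjoin F (Set.range v)) (IntermediateField.adjoin F (Set.range v)) :=
    .of_isLocalization (nonZeroDivisors _)
  have h2 : Algebra.FormallyEtale (IntermediateField.adjoin F (Set.range v)) K :=
    Algebra.FormallyEtale.of_isSeparable _ K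
  have h3 : Algebra.FormallyEtale (Algebra.adjoin F (Set.range v)) K :=
    .comp _ (IntermediateField.adjoin F (Set.range v)) _
  let P := MvPolynomial ι F
  let e : P ≃ₐ[F] (Algebra.adjoin F (Set.range v)) := hb.aevalEquiv
  let : Algebra P (Algebra.adjoin F (Set.range v)) := e.toRingEquiv.toRingHom.toAlgebra
  have : IsScalarTower F P (Algebra.adjoin F (Set.range v)) := .of_algebraMap_eq fun x => (e.commutes x).symm
  let e' : P ≃ₐ[P] (Algebra.adjoin F (Set.range v)) := { e.toRingEquiv with commutes' := fun _ => rfl }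
  have h4 : Algebra.FormallyEtale P (Algebra.adjoin F (Set.range v)) := .of_equiv e'
  let b0 := (KaehlerDifferential.mvPolynomialBasis F ι).baseChange (Algebra.adjoin F (Set.range v))
  let b1 := b0.map (KaehlerDifferential.tensorKaehlerEquivOfFormallyEtale F P (Algebra.adjoin F (Set.range v)))
  let b2 := (b1.baseChange K).map (KaehlerDifferential.tensorKaehlerEquivOfFormallyEtale F (Algebra.adjoin F (Set.range v)) K)
  exact b2.mk_eq_rank''.symm



/-- **Proposition 4.3.** For a finitely generated field extension `K` of a perfect
field `F` of characteristic `p > 0`, the `p`-degree equals the transcendence degree: the rank of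
the `K`-vector space of Kähler differentials `Ω_{K/F}` equals the cardinality of any
transcendence basis of `K` over `F`. -/
theorem rank_kaehlerDifferential_eq_trdeg_of_perfectField
    (p : ℕ) [Fact p.Prime]
    (F K : Type) [Field F] [Field K] [PerfectField F] [CharP F p] [Algebra F K]
    (hfg : (⊤ : IntermediateField F K).FG)
    (ι : Type) (b : ι → K) (hb : IsTranscendenceBasis F b) :
    Module.rank K (Ω[K⁄F]) = Cardinal.mk ι := by
  have : Algebra.EssFiniteType F K := by
    have := IntermediateField.essFiniteType_iff.mpr hfg
    exact Algebra.EssFiniteType.of_surjective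
      (IntermediateField.topEquiv (F := F) (E := K)).toAlgHom
      IntermediateField.topEquiv.surjective
  obtain ⟨s, hs, H⟩ := exists_isTranscendenceBasis_and_isSeparable_of_perfectField F K
  have : Algebra.IsSeparable (IntermediateField.adjoin F (Set.range ((↑) : s → K))) K := by
    convert! H <;> simp
  rw [rank_kaehler_aux F K _ hs.1]
  exact hs.cardinalMk_eq hb
end
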